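/- Fix n ≥ 1 and let A, X, Y, Z : ℝ → Matrix (Fin n) (Fin n) ℝ be smooth (entrywise) 2π-periodic matrix-valued functions. Define the pointwise commutator [X,Y](x) = X(x)Y(x) − Y(x)X(x), the functional c(X,Y;A) = ∫₀^{2π} trace(A(x)·[X,Y](x)) dx, and the infinitesimal gauge variation δ_X A = X′ + [A,X] (pointwise, ′ the entrywise derivative). Then the Chevalley–Eilenberg 2-cocycle identity holds: c(Y,Z; δ_X A) − c(X,Z; δ_Y A) + c(X,Y; δ_Z A) − c([X,Y],Z; A) + c([X,Z],Y; A) − c([Y,Z],X; A) = 0. -/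

import Mathlib

open Real

/-- A matrix-valued function on `ℝ` all of whose entries are smooth and
2π-periodic (a gauge potential / infinitesimal gauge transformation on the circle). -/
def MatSmoothPeriodic {n : ℕ} (A : ℝ → Matrix (Fin n) (Fin n) ℝ) : Prop :=
  (∀ i j, ContDiff ℝ (⊤ : ℕ∞) fun x => A x i j) ∧ ∀ x, A (x + 2 * π) = A x

/-- Entrywise derivative of a matrix-valued function. -/
noncomputable def matDeriv {n : ℕ} (X : ℝ → Matrix (Fin n) (Fin n) ℝ) :
    ℝ → Matrix (Fin n) (Fin n) ℝ :=
  fun x => Matrix.of fun i j => deriv (fun t => X t i j) x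

/-- Pointwise commutator `[X,Y](x) = X(x)Y(x) − Y(x)X(x)`. -/
def matComm {n : ℕ} (X Y : ℝ → Matrix (Fin n) (Fin n) ℝ) :
    ℝ → Matrix (Fin n) (Fin n) ℝ :=
  fun x => X x * Y x - Y x * X x

/-- The Schwinger term `c(X,Y;A) = ∫₀^{2π} tr(A(x)·[X,Y](x)) dx`. -/
noncomputable def gaugeC {n : ℕ} (X Y A : ℝ → Matrix (Fin n) (Fin n) ℝ) : ℝ :=
  ∫ x in (0:ℝ)..(2 * π), Matrix.trace (A x * matComm X Y x)

/-- Infinitesimal gauge variation `δ_X A = X′ + [A,X]` (pointwise). -/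
noncomputable def gaugeVar {n : ℕ} (X A : ℝ → Matrix (Fin n) (Fin n) ℝ) :
    ℝ → Matrix (Fin n) (Fin n) ℝ :=
  fun x => matDeriv X x + (A x * X x - X x * A x)

open MeasureTheory Matrix

theorem MatSmoothPeriodic.continuous {n : ℕ} {A : ℝ → Matrix (Fin n) (Fin n) ℝ}
    (hA : MatSmoothPeriodic A) : Continuous A :=
  continuous_matrix fun i j => (hA.1 i j).continuous

theorem MatSmoothPeriodic.continuous_matDeriv {n : ℕ} {A : ℝ → Matrix (Fin n) (Fin n) ℝ}
    (hA : MatSmoothPeriodic A) : Continuous (matDeriv A) :=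
  continuous_matrix fun i j => (hA.1 i j).continuous_deriv (by simp)

theorem MatSmoothPeriodic.hasDerivAt_apply {n : ℕ} {A : ℝ → Matrix (Fin n) (Fin n) ℝ}
    (hA : MatSmoothPeriodic A) (x : ℝ) (i j : Fin n) :
    HasDerivAt (fun t => A t i j) (matDeriv A x i j) x :=
  ((hA.1 i j).differentiable (by simp) x).hasDerivAt

theorem hasDerivAt_matrix_mul_apply {n : ℕ} {X Y : ℝ → Matrix (Fin n) (Fin n) ℝ}
    {X' Y' : Matrix (Fin n) (Fin n) ℝ} {x : ℝ}
    (hX : ∀ i j, HasDerivAt (fun t => X t i j) (X' i j) x)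
    (hY : ∀ i j, HasDerivAt (fun t => Y t i j) (Y' i j) x) (i j : Fin n) :
    HasDerivAt (fun t => (X t * Y t) i j) ((X' * Y x + X x * Y') i j) x := by
  simp only [Matrix.add_apply, Matrix.mul_apply, ← Finset.sum_add_distrib]
  exact HasDerivAt.fun_sum fun k _ => (hX i k).mul (hY k j)

theorem hasDerivAt_matComm_apply {n : ℕ} {X Y : ℝ → Matrix (Fin n) (Fin n) ℝ}
    {X' Y' : Matrix (Fin n) (Fin n) ℝ} {x : ℝ}
    (hX : ∀ i j, HasDerivAt (fun t => X t i j) (X' i j) x)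
    (hY : ∀ i j, HasDerivAt (fun t => Y t i j) (Y' i j) x) (i j : Fin n) :
    HasDerivAt (fun t => matComm X Y t i j)
      (((X' * Y x + X x * Y') - (Y' * X x + Y x * X')) i j) x :=
  (hasDerivAt_matrix_mul_apply hX hY i j).sub (hasDerivAt_matrix_mul_apply hY hX i j)

theorem Continuous.matComm {n : ℕ} {X Y : ℝ → Matrix (Fin n) (Fin n) ℝ}
    (hX : Continuous X) (hY : Continuous Y) : Continuous (matComm X Y) :=
  (hX.mul hY).sub (hY.mul hX)

theorem MatSmoothPeriodic.continuous_gaugeVar {n : ℕ} {X A : ℝ → Matrix (Fin n) (Fin n) ℝ}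
    (hX : MatSmoothPeriodic X) (hA : Continuous A) : Continuous (gaugeVar X A) :=
  hX.continuous_matDeriv.add (hA.matComm hX.continuous)

theorem intervalIntegrable_trace_mul_matComm {n : ℕ}
    {A X Y : ℝ → Matrix (Fin n) (Fin n) ℝ}
    (hA : Continuous A) (hX : Continuous X) (hY : Continuous Y) (a b : ℝ) :
    IntervalIntegrable (fun x => trace (A x * matComm X Y x)) volume a b :=
  (hA.mul (hX.matComm hY)).matrix_trace.intervalIntegrable a b

/-- Invariance of the trace form under the commutator. -/
theorem trace_commutator_mul {ι R : Type*} [Fintype ι] [CommRing R] (A X W : Matrix ι ι R) :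
    trace ((A * X - X * A) * W) = trace (A * (X * W - W * X)) := by
  simp only [sub_mul, mul_sub, trace_sub]
  rw [mul_assoc X A W, trace_mul_comm X (A * W), mul_assoc, mul_assoc]

/-- The part of the cocycle identity that contains no derivative reduces to the Jacobi identity. -/
theorem trace_jacobi {ι R : Type*} [Fintype ι] [CommRing R] (A X Y Z : Matrix ι ι R) :
    trace ((A * X - X * A) * (Y * Z - Z * Y)) - trace ((A * Y - Y * A) * (X * Z - Z * X))
      + trace ((A * Z - Z * A) * (X * Y - Y * X))
      - trace (A * ((X * Y - Y * X) * Z - Z * (X * Y - Y * X)))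
      + trace (A * ((X * Z - Z * X) * Y - Y * (X * Z - Z * X)))
      - trace (A * ((Y * Z - Z * Y) * X - X * (Y * Z - Z * Y))) = 0 := by
  rw [trace_commutator_mul, trace_commutator_mul, trace_commutator_mul]
  simp only [← trace_sub, ← trace_add]
  rw [← trace_zero ι R]
  congr 1
  noncomm_ring

/-- The Leibniz expansion of `tr(X[Y,Z])`, with each derivative moved to the front. -/
theorem trace_leibniz {ι R : Type*} [Fintype ι] [CommRing R] (X Y Z X' Y' Z' : Matrix ι ι R) :
    trace (X' * (Y * Z - Z * Y)
        + X * ((Y' * Z + Y * Z') - (Z' * Y + Z * Y')))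
      = trace (X' * (Y * Z - Z * Y)) - trace (Y' * (X * Z - Z * X))
        + trace (Z' * (X * Y - Y * X)) := by
  have rot (P Q S : Matrix ι ι R) : trace (P * (Q * S)) = trace (Q * (S * P)) := by
    rw [trace_mul_comm, mul_assoc]
  simp only [mul_sub, mul_add, trace_sub, trace_add]
  rw [rot X Y' Z, rot X Y Z', rot Y Z' X, rot X Z' Y, rot X Z Y', rot Z Y' X]
  ring

/-- The derivative part of the cocycle identity is the integral of a total derivative of a
periodic function. -/
theorem integral_trace_leibniz_eq_zero {n : ℕ} {X Y Z : ℝ → Matrix (Fin n) (Fin n) ℝ}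
    (hX : MatSmoothPeriodic X) (hY : MatSmoothPeriodic Y) (hZ : MatSmoothPeriodic Z) :
    ∫ x in (0:ℝ)..(2 * π), (trace (matDeriv X x * matComm Y Z x)
      - trace (matDeriv Y x * matComm X Z x) + trace (matDeriv Z x * matComm X Y x)) = 0 := by
  have hderiv (x : ℝ) : HasDerivAt (fun t => trace (X t * matComm Y Z t))
      (trace (matDeriv X x * matComm Y Z x) - trace (matDeriv Y x * matComm X Z x)
        + trace (matDeriv Z x * matComm X Y x)) x := by
    unfold matComm
    rw [← trace_leibniz]
    exact HasDerivAt.fun_sum fun i _ => hasDerivAt_matrix_mul_apply (hX.hasDerivAt_apply x)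
      (hasDerivAt_matComm_apply (hY.hasDerivAt_apply x) (hZ.hasDerivAt_apply x)) i i
  have hXc := hX.continuous
  have hYc := hY.continuous
  have hZc := hZ.continuous
  rw [intervalIntegral.integral_eq_sub_of_hasDerivAt (fun x _ => hderiv x)
    (((intervalIntegrable_trace_mul_matComm hX.continuous_matDeriv hYc hZc _ _).sub
      (intervalIntegrable_trace_mul_matComm hY.continuous_matDeriv hXc hZc _ _)).add
      (intervalIntegrable_trace_mul_matComm hZ.continuous_matDeriv hXc hYc _ _))]
  have hXp := hX.2 0
  have hYp := hY.2 0
  have hZp := hZ.2 0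
  rw [zero_add] at hXp hYp hZp
  simp only [matComm, hXp, hYp, hZp, sub_self]

/-- The gauge Schwinger term `c(X,Y;A) = ∫₀^{2π} tr(A[X,Y])` satisfies the
Chevalley–Eilenberg 2-cocycle identity for the gauge algebra acting on
functionals of the gauge potential `A`. -/
theorem gaugeC_cocycle {n : ℕ} (hn : 1 ≤ n)
    (A X Y Z : ℝ → Matrix (Fin n) (Fin n) ℝ)
    (hA : MatSmoothPeriodic A) (hX : MatSmoothPeriodic X)
    (hY : MatSmoothPeriodic Y) (hZ : MatSmoothPeriodic Z) :
    gaugeC Y Z (gaugeVar X A) - gaugeC X Z (gaugeVar Y A)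
      + gaugeC X Y (gaugeVar Z A)
      - gaugeC (matComm X Y) Z A + gaugeC (matComm X Z) Y A
      - gaugeC (matComm Y Z) X A = 0 := by
  have hAc := hA.continuous
  have hXc := hX.continuous
  have hYc := hY.continuous
  have hZc := hZ.continuous
  have i₁ := intervalIntegrable_trace_mul_matComm (hX.continuous_gaugeVar hAc) hYc hZc 0 (2 * π)
  have i₂ := intervalIntegrable_trace_mul_matComm (hY.continuous_gaugeVar hAc) hXc hZc 0 (2 * π)
  have i₃ := intervalIntegrable_trace_mul_matComm (hZ.continuous_gaugeVar hAc) hXc hYc 0 (2 * π)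
  have i₄ := intervalIntegrable_trace_mul_matComm hAc (hXc.matComm hYc) hZc 0 (2 * π)
  have i₅ := intervalIntegrable_trace_mul_matComm hAc (hXc.matComm hZc) hYc 0 (2 * π)
  have i₆ := intervalIntegrable_trace_mul_matComm hAc (hYc.matComm hZc) hXc 0 (2 * π)
  unfold gaugeC
  rw [← intervalIntegral.integral_sub i₁ i₂, ← intervalIntegral.integral_add (i₁.sub i₂) i₃,
    ← intervalIntegral.integral_sub ((i₁.sub i₂).add i₃) i₄,
    ← intervalIntegral.integral_add (((i₁.sub i₂).add i₃).sub i₄) i₅,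
    ← intervalIntegral.integral_sub ((((i₁.sub i₂).add i₃).sub i₄).add i₅) i₆]
  refine Eq.trans ?_ (integral_trace_leibniz_eq_zero hX hY hZ)
  congr 1
  funext x
  have hJ := trace_jacobi (A x) (X x) (Y x) (Z x)
  simp only [gaugeVar, matComm, add_mul _ _ (_ - _), trace_add]
  linear_combination hJ
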